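/- arXiv:2309.15010 — 3 statements merged into one kernel-verified Lean document; each statement's English description precedes it below -/
import Mathlib

section
/- Let π : C → ℂ be defined by π(z, w) = z⁴. Then π ∘ τ = π on C, and for every x₀ ∈ ℂ with x₀ ≠ 0 and x₀ ≠ 1, the cyclic group generated by τ acts simply transitively on the fiber π⁻¹(x₀) ∩ C; in particular this fiber has exactly 12 elements. -/
open Complex

/-- The octahedral model of Schoen's I-WP surface. -/
def Ccurve : Set (ℂ × ℂ) := {p | p.2 ^ 3 = p.1 * (p.1 ^ 4 - 1)}

/-- The map `τ(z, w) = (i z, e^{iπ/6} w)`. -/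
noncomputable def τ : ℂ × ℂ → ℂ × ℂ :=
  fun p => (Complex.I * p.1, Complex.exp (Real.pi * Complex.I / 6) * p.2)

/-- The 12-fold branched covering map `π(z, w) = z⁴` of `S₁₄₇` over the thrice
punctured sphere. -/
def πmap : ℂ × ℂ → ℂ := fun p => p.1 ^ 4

theorem isPrimitiveRoot_exp_pi_mul_I_div_six :
    IsPrimitiveRoot (Complex.exp (Real.pi * Complex.I / 6)) 12 := by
  convert Complex.isPrimitiveRoot_exp 12 (by norm_num) using 2
  push_cast
  ring

theorem exp_pi_mul_I_div_six_pow_three :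
    Complex.exp (Real.pi * Complex.I / 6) ^ 3 = Complex.I := by
  rw [← Complex.exp_nat_mul]
  refine (congrArg Complex.exp ?_).trans Complex.exp_pi_div_two_mul_I
  push_cast
  ring

theorem τ_iterate (k : ℕ) (p : ℂ × ℂ) :
    τ^[k] p = (Complex.I ^ k * p.1, Complex.exp (Real.pi * Complex.I / 6) ^ k * p.2) := by
  induction k with
  | zero => simp
  | succ k ih =>
    rw [Function.iterate_succ_apply', ih]
    simp only [τ, pow_succ']
    ext <;> simp only [mul_assoc]

theorem πmap_τ (p : ℂ × ℂ) : πmap (τ p) = πmap p := by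
  simp [πmap, τ, mul_pow, Complex.I_pow_four]

theorem τ_mem_Ccurve {p : ℂ × ℂ} (hp : p ∈ Ccurve) : τ p ∈ Ccurve := by
  simp only [Ccurve, Set.mem_ofPred_eq, τ, mul_pow, exp_pi_mul_I_div_six_pow_three,
    Complex.I_pow_four, one_mul] at hp ⊢
  rw [hp, mul_assoc]

theorem mapsTo_τ_fiber (x₀ : ℂ) :
    Set.MapsTo τ {q ∈ Ccurve | πmap q = x₀} {q ∈ Ccurve | πmap q = x₀} :=
  fun p hp => ⟨τ_mem_Ccurve hp.1, (πmap_τ p).trans hp.2⟩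

theorem fst_mul_eq_of_mem_fiber {x₀ : ℂ} {p : ℂ × ℂ}
    (hp : p ∈ {q ∈ Ccurve | πmap q = x₀}) : p.2 ^ 3 = p.1 * (x₀ - 1) := by
  obtain ⟨hC, rfl⟩ := hp
  exact hC

theorem snd_pow_twelve_of_mem_fiber {x₀ : ℂ} {p : ℂ × ℂ}
    (hp : p ∈ {q ∈ Ccurve | πmap q = x₀}) : p.2 ^ 12 = x₀ * (x₀ - 1) ^ 4 := by
  rw [show p.2 ^ 12 = (p.2 ^ 3) ^ 4 by ring, fst_mul_eq_of_mem_fiber hp, mul_pow]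
  exact congrArg (· * (x₀ - 1) ^ 4) hp.2

theorem snd_ne_zero_of_mem_fiber {x₀ : ℂ} (h0 : x₀ ≠ 0) (h1 : x₀ ≠ 1) {p : ℂ × ℂ}
    (hp : p ∈ {q ∈ Ccurve | πmap q = x₀}) : p.2 ≠ 0 := by
  intro h
  have h12 := snd_pow_twelve_of_mem_fiber hp
  rw [h, zero_pow (by norm_num)] at h12
  exact mul_ne_zero h0 (pow_ne_zero 4 (sub_ne_zero.mpr h1)) h12.symm

theorem existsUnique_τ_iterate_eq {x₀ : ℂ} (h0 : x₀ ≠ 0) (h1 : x₀ ≠ 1) {p q : ℂ × ℂ}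
    (hp : p ∈ {q ∈ Ccurve | πmap q = x₀}) (hq : q ∈ {q ∈ Ccurve | πmap q = x₀}) :
    ∃! k : Fin 12, τ^[(k : ℕ)] p = q := by
  have hζ := isPrimitiveRoot_exp_pi_mul_I_div_six
  have hp2 := snd_ne_zero_of_mem_fiber h0 h1 hp
  have hx : x₀ - 1 ≠ 0 := sub_ne_zero.mpr h1
  have hroot : (q.2 / p.2) ^ 12 = 1 := by
    rw [div_pow, snd_pow_twelve_of_mem_fiber hq, ← snd_pow_twelve_of_mem_fiber hp]
    exact div_self (pow_ne_zero 12 hp2)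
  obtain ⟨k, hk, hkq⟩ := hζ.eq_pow_of_pow_eq_one hroot
  have hsnd : Complex.exp (Real.pi * Complex.I / 6) ^ k * p.2 = q.2 := by
    rw [hkq, div_mul_cancel₀ _ hp2]
  have hfst : Complex.I ^ k * p.1 = q.1 := by
    apply mul_right_cancel₀ hx
    rw [← fst_mul_eq_of_mem_fiber hq, ← hsnd, mul_pow, fst_mul_eq_of_mem_fiber hp,
      pow_right_comm, exp_pi_mul_I_div_six_pow_three, mul_assoc]
  have hτ : τ^[k] p = q := by rw [τ_iterate, hfst, hsnd]
  refine ⟨⟨k, hk⟩, hτ, fun j hj => Fin.ext (hζ.pow_inj j.2 hk ?_)⟩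
  have hjk := congrArg Prod.snd (hj.trans hτ.symm)
  rw [τ_iterate, τ_iterate] at hjk
  exact mul_right_cancel₀ hp2 hjk

theorem fiber_nonempty (x₀ : ℂ) : {q ∈ Ccurve | πmap q = x₀}.Nonempty := by
  obtain ⟨z, hz⟩ := IsAlgClosed.exists_pow_nat_eq x₀ (n := 4) (by norm_num)
  obtain ⟨w, hw⟩ := IsAlgClosed.exists_pow_nat_eq (z * (z ^ 4 - 1)) (n := 3) (by norm_num)
  exact ⟨(z, w), hw, hz⟩

/-- `π ∘ τ = π` on `C`, and over every unbranched value `x₀ ∉ {0, 1}` the cyclic group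
generated by `τ` acts simply transitively on the fiber, which has exactly 12 elements. -/
theorem tau_deck_transformation :
    (∀ p ∈ Ccurve, πmap (τ p) = πmap p) ∧
    ∀ x₀ : ℂ, x₀ ≠ 0 → x₀ ≠ 1 →
      (∀ p ∈ {q ∈ Ccurve | πmap q = x₀}, ∀ q ∈ {q ∈ Ccurve | πmap q = x₀},
        ∃! k : Fin 12, τ^[(k : ℕ)] p = q) ∧
      Set.ncard {q ∈ Ccurve | πmap q = x₀} = 12 := by
  refine ⟨fun p _ => πmap_τ p, fun x₀ h0 h1 =>
    ⟨fun p hp q hq => existsUnique_τ_iterate_eq h0 h1 hp hq, ?_⟩⟩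
  obtain ⟨p, hp⟩ := fiber_nonempty x₀
  have hmem (k : ℕ) := (mapsTo_τ_fiber x₀).iterate k hp
  have hrange : Set.range (fun k : Fin 12 => τ^[(k : ℕ)] p) = {q ∈ Ccurve | πmap q = x₀} :=
    Set.Subset.antisymm (Set.range_subset_iff.mpr fun k => hmem k)
      fun q hq => (existsUnique_τ_iterate_eq h0 h1 hp hq).exists
  have hinj : Function.Injective (fun k : Fin 12 => τ^[(k : ℕ)] p) := fun j k hjk =>
    (existsUnique_τ_iterate_eq h0 h1 hp (hmem k)).unique hjk rfl
  rw [← hrange, Set.ncard_range_of_injective hinj, Nat.card_fin]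
end

section
/- The map Φ(x, y) = (y³/(x−1), y) is a bijection from S* = {(x, y) ∈ ℂ² : y¹² = x(x−1)⁴, x ≠ 0, x ≠ 1} onto {(z, w) ∈ ℂ² : w³ = z(z⁴−1), z ≠ 0, z⁴ ≠ 1}, with inverse Ψ(z, w) = (z⁴, w). -/
open Complex

/-- The unbranched part of the cyclic 12-fold cover model `S₁₄₇` of Schoen's I-WP surface. -/
def Sstar : Set (ℂ × ℂ) :=
  {p | p.2 ^ 12 = p.1 * (p.1 - 1) ^ 4 ∧ p.1 ≠ 0 ∧ p.1 ≠ 1}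

/-- The unbranched part of the octahedral model of Schoen's I-WP surface. -/
def Cstar : Set (ℂ × ℂ) :=
  {p | p.2 ^ 3 = p.1 * (p.1 ^ 4 - 1) ∧ p.1 ≠ 0 ∧ p.1 ^ 4 ≠ 1}

/-- The substitution `z = x^{1/4}`, realized as `Φ(x, y) = (y³/(x−1), y)`. -/
noncomputable def Φ : ℂ × ℂ → ℂ × ℂ := fun p => (p.2 ^ 3 / (p.1 - 1), p.2)

/-- The inverse substitution `Ψ(z, w) = (z⁴, w)`. -/
def Ψ : ℂ × ℂ → ℂ × ℂ := fun p => (p.1 ^ 4, p.2)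

theorem Φ_fst_pow_four {p : ℂ × ℂ} (hp : p ∈ Sstar) : (Φ p).1 ^ 4 = p.1 := by
  obtain ⟨h, -, h1⟩ := hp
  have hx : p.1 - 1 ≠ 0 := sub_ne_zero.mpr h1
  simp only [Φ, div_pow, ← pow_mul]
  rw [div_eq_iff (pow_ne_zero 4 hx)]
  exact h

theorem Ψ_Φ {p : ℂ × ℂ} (hp : p ∈ Sstar) : Ψ (Φ p) = p :=
  Prod.ext (Φ_fst_pow_four hp) rfl

theorem Φ_Ψ {q : ℂ × ℂ} (hq : q ∈ Cstar) : Φ (Ψ q) = q := by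
  obtain ⟨h, -, h1⟩ := hq
  refine Prod.ext ?_ rfl
  simp only [Φ, Ψ]
  rw [div_eq_iff (sub_ne_zero.mpr h1)]
  exact h

theorem mapsTo_Φ : Set.MapsTo Φ Sstar Cstar := by
  intro p hp
  have h4 := Φ_fst_pow_four hp
  obtain ⟨-, h0, h1⟩ := hp
  refine ⟨?_, fun hz => h0 ?_, h4 ▸ h1⟩
  · rw [h4]
    exact (div_mul_cancel₀ _ (sub_ne_zero.mpr h1)).symm
  · rw [← h4, hz, zero_pow four_ne_zero]

theorem mapsTo_Ψ : Set.MapsTo Ψ Cstar Sstar := by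
  rintro q ⟨h, h0, h1⟩
  refine ⟨?_, pow_ne_zero 4 h0, h1⟩
  change q.2 ^ 12 = q.1 ^ 4 * (q.1 ^ 4 - 1) ^ 4
  rw [← mul_pow, ← h, ← pow_mul]

/-- `Φ` is a bijection from `S*` onto `C*` with inverse `Ψ`. -/
theorem phi_bijection :
    Set.BijOn Φ Sstar Cstar ∧
    Set.MapsTo Ψ Cstar Sstar ∧
    (∀ p ∈ Sstar, Ψ (Φ p) = p) ∧
    (∀ q ∈ Cstar, Φ (Ψ q) = q) := by
  exact ⟨Set.InvOn.bijOn (f' := Ψ) ⟨fun _ hp => Ψ_Φ hp, fun _ hq => Φ_Ψ hq⟩ mapsTo_Φ mapsTo_Ψ,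
    mapsTo_Ψ, fun _ hp => Ψ_Φ hp, fun _ hq => Φ_Ψ hq⟩
end

section
/- Let σ : ℂ² → ℂ² be σ(x, y) = (x, e^{iπ/6}·y) and τ : ℂ² → ℂ² be τ(z, w) = (i·z, e^{iπ/6}·w). Then σ maps S* = {(x,y) : y¹² = x(x−1)⁴, x ≠ 0, x ≠ 1} into itself, σ has order exactly 12 on S*, and the bijection Φ(x, y) = (y³/(x−1), y) intertwines the two automorphisms: Φ ∘ σ = τ ∘ Φ on S*. -/
open Complex

/-- The deck transformation `σ(x, y) = (x, e^{iπ/6} y)` of `S₁₄₇`. -/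
noncomputable def σ : ℂ × ℂ → ℂ × ℂ :=
  fun p => (p.1, Complex.exp (Real.pi * Complex.I / 6) * p.2)

theorem σ_iterate (k : ℕ) (p : ℂ × ℂ) :
    σ^[k] p = (p.1, Complex.exp (Real.pi * Complex.I / 6) ^ k * p.2) := by
  induction k with
  | zero => simp
  | succ k ih => rw [Function.iterate_succ_apply', ih, σ, pow_succ', mul_assoc]

/-- `σ` maps `S*` into itself, has order exactly 12 on `S*`, and `Φ` intertwines
`σ` with `τ`: `Φ ∘ σ = τ ∘ Φ` on `S*`. -/
theorem sigma_order_twelve_and_intertwining :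
    Set.MapsTo σ Sstar Sstar ∧
    (∀ p ∈ Sstar, σ^[12] p = p) ∧
    (∀ k : ℕ, 0 < k → k < 12 → ∃ p ∈ Sstar, σ^[k] p ≠ p) ∧
    (∀ p ∈ Sstar, Φ (σ p) = τ (Φ p)) := by
  have hprim := isPrimitiveRoot_exp_pi_mul_I_div_six
  refine ⟨?_, ?_, ?_, ?_⟩
  · rintro p ⟨h, h0, h1⟩
    refine ⟨?_, h0, h1⟩
    simp only [σ]
    rw [mul_pow, hprim.pow_eq_one, one_mul, h]
  · intro p _
    rw [σ_iterate, hprim.pow_eq_one, one_mul]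
  · intro k hk hk'
    obtain ⟨y, hy⟩ := IsAlgClosed.exists_pow_nat_eq (2 : ℂ) (n := 12) (by norm_num)
    have hy0 : y ≠ 0 := by
      rintro rfl
      norm_num at hy
    refine ⟨(2, y), ⟨?_, by norm_num, by norm_num⟩, ?_⟩
    · norm_num [hy]
    · rw [σ_iterate]
      intro h
      exact hprim.pow_ne_one_of_pos_of_lt hk.ne' hk'
        (mul_right_cancel₀ hy0 ((congrArg Prod.snd h).trans (one_mul y).symm))
  · intro p _
    simp only [Φ, σ, τ]
    rw [mul_pow, exp_pi_mul_I_div_six_pow_three, mul_div_assoc]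
end
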